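/- Let x, y, z be pyramidal tours with step-backs whose vertices are pairwise adjacent in PSB(n), and suppose all three encodings agree on a 0/1-segment at coordinates (k, k+1) (one city ascending, one descending). If the encodings of x and y coincide on coordinates [1,k] and the encodings of x and z coincide on coordinates [k+1,n], then y = x or z = x. Consequently, for any set of pairwise adjacent tours sharing a common 0/1-segment, all coinciding parts lie on the same side of the segment. -/

import Mathlib

/-- A Hamiltonian tour on the cities `{1,…,n}` (represented as `Fin n`,
city `c` corresponding to the element `c-1`): a permutation acting cyclically on all cities. -/
def IsTour {n : ℕ} (τ : Equiv.Perm (Fin n)) : Prop :=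
  ∀ i j : Fin n, ∃ k : ℕ, (τ ^ k) i = j

/-- `i` is a peak of the tour `τ`. -/
def IsPeak {n : ℕ} (τ : Equiv.Perm (Fin n)) (i : Fin n) : Prop :=
  τ⁻¹ i < i ∧ τ i < i

/-- `i` is a step-back peak of `τ`: either `τ⁻¹ i < i`, `τ i = i - 1`, `τ² i > i`
(ascending step-back) or `τ⁻² i > i`, `τ⁻¹ i = i - 1`, `τ i < i` (descending step-back). -/
def IsStepBackPeak {n : ℕ} (τ : Equiv.Perm (Fin n)) (i : Fin n) : Prop :=
  (τ⁻¹ i < i ∧ ((τ i : ℕ) + 1 = (i : ℕ)) ∧ i < τ (τ i)) ∨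
  (i < τ⁻¹ (τ⁻¹ i) ∧ ((τ⁻¹ i : ℕ) + 1 = (i : ℕ)) ∧ τ i < i)

/-- A pyramidal tour: a Hamiltonian tour whose unique peak is the last city `n`. -/
def IsPyramidal {n : ℕ} (τ : Equiv.Perm (Fin n)) : Prop :=
  IsTour τ ∧ ∀ i : Fin n, IsPeak τ i ↔ (i : ℕ) = n - 1

/-- A pyramidal tour with step-backs: a Hamiltonian tour with exactly one proper peak
(a peak that is not a step-back peak), namely the last city `n`. -/
def IsPSB {n : ℕ} (τ : Equiv.Perm (Fin n)) : Prop :=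
  IsTour τ ∧ ∀ i : Fin n, (IsPeak τ i ∧ ¬ IsStepBackPeak τ i) ↔ (i : ℕ) = n - 1

/-- City `i` is visited by `τ` in ascending order (taking step-backs into account):
either the successor of `i` is larger and `i` is not the lower city of a descending
step-back, or `i` is an ascending step-back peak. -/
def Ascends {n : ℕ} (τ : Equiv.Perm (Fin n)) (i : Fin n) : Prop :=
  (i < τ i ∧ ¬ (((i : ℕ) + 1 = (τ i : ℕ)) ∧ τ (τ i) < τ i ∧ τ i < τ⁻¹ i)) ∨
  (τ⁻¹ i < i ∧ ((τ i : ℕ) + 1 = (i : ℕ)) ∧ i < τ (τ i))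

/-- The city represented by the element of `Fin n` with value `m` is visited ascending. -/
def AscAt {n : ℕ} (τ : Equiv.Perm (Fin n)) (m : ℕ) : Prop :=
  ∃ i : Fin n, (i : ℕ) = m ∧ Ascends τ i

/-- The city represented by the element of `Fin n` with value `m` is a step-back peak. -/
def SBPeakAt {n : ℕ} (τ : Equiv.Perm (Fin n)) (m : ℕ) : Prop :=
  ∃ i : Fin n, (i : ℕ) = m ∧ IsStepBackPeak τ i

/-- The pyramidal encodings of `x` and `y` have the same value at coordinate `m`. -/
def SameEnc {n : ℕ} (x y : Equiv.Perm (Fin n)) (m : ℕ) : Prop :=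
  (AscAt x m ↔ AscAt y m) ∧ (SBPeakAt x m ↔ SBPeakAt y m)

/-- The pyramidal encodings of `x` and `y` agree on the pair of neighboring
coordinates `(k, k+1)`, including the step-back marks overlapping the pair. -/
def SamePair {n : ℕ} (x y : Equiv.Perm (Fin n)) (k : ℕ) : Prop :=
  SameEnc x y k ∧ SameEnc x y (k + 1) ∧ (SBPeakAt x (k + 2) ↔ SBPeakAt y (k + 2))

/-- Characteristic vector of a tour, in `ℝ^E` with `E = Fin n × Fin n`. -/
def chv {n : ℕ} (τ : Equiv.Perm (Fin n)) : Fin n × Fin n → ℝ :=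
  fun e => if τ e.1 = e.2 then 1 else 0

/-- The vertices of the polytope `PSB(n)`: characteristic vectors of all
pyramidal tours with step-backs. -/
def PSBvertices (n : ℕ) : Set (Fin n × Fin n → ℝ) :=
  chv '' {τ : Equiv.Perm (Fin n) | IsPSB τ}

/-- `u` and `w` are adjacent vertices in the 1-skeleton of the polytope `conv S`:
the segment `[u,w]` is a one-dimensional face (an extreme subset) of the polytope. -/
def AdjacentIn {n : ℕ} (S : Set (Fin n × Fin n → ℝ)) (u w : Fin n × Fin n → ℝ) : Prop :=
  u ≠ w ∧ IsExtreme ℝ (convexHull ℝ S) (segment ℝ u w)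


/-- Abstract data of a pyramidal tour with step-backs on natural numbers:
successor `s` and predecessor `p`. -/
structure PT (n : ℕ) (s p : ℕ → ℕ) : Prop where
  hn : 4 ≤ n
  sp : ∀ m, s (p m) = m
  ps : ∀ m, p (s m) = m
  slt : ∀ m, m < n → s m < n
  plt : ∀ m, m < n → p m < n
  sne : ∀ m, m < n → s m ≠ m
  two : ∀ m, m < n → s m ≠ p m
  peak : ∀ m, m < n → p m < m → s m < m →
    m = n - 1 ∨ (p m < m ∧ s m + 1 = m ∧ m < s (s m)) ∨ (m < p (p m) ∧ p m + 1 = m ∧ s m < m)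

/-- step-back peak -/
def SBN (n : ℕ) (s p : ℕ → ℕ) (m : ℕ) : Prop :=
  m < n ∧ ((p m < m ∧ s m + 1 = m ∧ m < s (s m)) ∨ (m < p (p m) ∧ p m + 1 = m ∧ s m < m))

/-- ascending city -/
def ASN (n : ℕ) (s p : ℕ → ℕ) (m : ℕ) : Prop :=
  m < n ∧ ((m < s m ∧ ¬ (m + 1 = s m ∧ s (s m) < s m ∧ s m < p m)) ∨
    (p m < m ∧ s m + 1 = m ∧ m < s (s m)))

namespace PT
variable {n : ℕ} {s p : ℕ → ℕ}

theorem pne (h : PT n s p) (m : ℕ) (hm : m < n) : p m ≠ m := by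
  intro e
  have := h.sp m
  rw [e] at this
  exact h.sne m hm this

theorem inv (h : PT n s p) : PT n p s where
  hn := h.hn
  sp := h.ps
  ps := h.sp
  slt := h.plt
  plt := h.slt
  sne := h.pne
  two := fun m hm e => h.two m hm e.symm
  peak := fun m hm h1 h2 => by
    have := h.peak m hm h2 h1
    tauto

theorem sb_inv (m : ℕ) : SBN n p s m ↔ SBN n s p m := by
  unfold SBN; tauto

/-- The upward crossing edges of the cut above `c`. -/
def up (s : ℕ → ℕ) (c : ℕ) : Finset ℕ := (Finset.range (c+1)).filter (fun j => c < s j)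
def pk (s p : ℕ → ℕ) (c : ℕ) : Finset ℕ :=
  (Finset.range (c+1)).filter (fun j => p j < j ∧ s j < j)
def vl (s p : ℕ → ℕ) (c : ℕ) : Finset ℕ :=
  (Finset.range (c+1)).filter (fun j => j < p j ∧ j < s j)

theorem count (h : PT n s p) (c : ℕ) (hc : c < n) :
    (up s c).card + (pk s p c).card = (vl s p c).card := by
  have e1 : ((Finset.range (c+1)).filter (fun j => j < s j)).card =
      (vl s p c).card + ((Finset.range (c+1)).filter (fun j => p j < j ∧ j < s j)).card := by
    rw [← Finset.card_union_of_disjoint]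
    · congr 1
      ext j
      simp only [vl, Finset.mem_union, Finset.mem_filter, Finset.mem_range]
      have := h.pne j
      omega
    · rw [Finset.disjoint_left]
      intro j
      simp only [vl, Finset.mem_filter, Finset.mem_range]
      omega
  have e2 : ((Finset.range (c+1)).filter (fun j => p j < j)).card =
      (pk s p c).card + ((Finset.range (c+1)).filter (fun j => p j < j ∧ j < s j)).card := by
    rw [← Finset.card_union_of_disjoint]
    · congr 1
      ext j
      simp only [pk, Finset.mem_union, Finset.mem_filter, Finset.mem_range]
      have := h.sne j
      omega
    · rw [Finset.disjoint_left]
      intro j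
      simp only [pk, Finset.mem_filter, Finset.mem_range]
      omega
  have e3 : ((Finset.range (c+1)).filter (fun j => j < s j)).card =
      (up s c).card + ((Finset.range (c+1)).filter (fun j => j < s j ∧ s j ≤ c)).card := by
    rw [← Finset.card_union_of_disjoint]
    · congr 1
      ext j
      simp only [up, Finset.mem_union, Finset.mem_filter, Finset.mem_range]
      omega
    · rw [Finset.disjoint_left]
      intro j
      simp only [up, Finset.mem_filter, Finset.mem_range]
      omega
  have e4 : ((Finset.range (c+1)).filter (fun j => j < s j ∧ s j ≤ c)).card =
      ((Finset.range (c+1)).filter (fun j => p j < j)).card := by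
    refine Finset.card_bij (fun j _ => s j) ?_ ?_ ?_
    · intro j
      simp only [Finset.mem_filter, Finset.mem_range, h.ps]
      omega
    · intro a _ b _ hab
      rw [← h.ps a, ← h.ps b, hab]
    · intro b hb
      simp only [Finset.mem_filter, Finset.mem_range] at hb
      refine ⟨p b, ?_, h.sp b⟩
      simp only [Finset.mem_filter, Finset.mem_range, h.sp]
      omega
  omega

theorem not_last (h : PT n s p) : ¬ SBN n s p (n-1) := by
  have h4 := h.hn
  rintro ⟨_, ⟨_, _, h3⟩ | ⟨h1, _, _⟩⟩
  · have := h.slt _ (h.slt (n-1) (by omega)); omega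
  · have := h.plt _ (h.plt (n-1) (by omega)); omega

/-- basic local facts about a step-back peak -/
theorem sb_data (h : PT n s p) (m : ℕ) (hm : SBN n s p m) :
    2 ≤ m ∧ m + 2 ≤ n ∧ p m < m ∧ s m < m ∧ m - 1 < p (m-1) ∧ m - 1 < s (m-1) := by
  have hl := h.not_last
  have hmn : m ≠ n - 1 := fun e => hl (e ▸ hm)
  obtain ⟨h0, ⟨h1, h2, h3⟩ | ⟨h1, h2, h3⟩⟩ := hm
  · have a := h.two m h0
    have e : m - 1 = s m := by omega
    have b := h.ps m
    rw [e, b]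
    omega
  · have a := h.two m h0
    have e : m - 1 = p m := by omega
    have b := h.sp m
    rw [e, b]
    omega

theorem valley (h : PT n s p) (v : ℕ) (hv : v < n) (h1 : v < p v) (h2 : v < s v) :
    v = 0 ∨ SBN n s p (v+1) := by
  have h4 := h.hn
  have hc := h.count (n-1) (by omega)
  have hu : (up s (n-1)).card = 0 := by
    rw [Finset.card_eq_zero, Finset.eq_empty_iff_forall_notMem]
    intro j
    simp only [up, Finset.mem_filter, Finset.mem_range]
    intro hj
    have := h.slt j
    omega
  have key : ∀ j ∈ pk s p (n-1), j = n-1 ∨ SBN n s p j := by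
    intro j
    simp only [pk, Finset.mem_filter, Finset.mem_range]
    intro hj
    rcases h.peak j (by omega) hj.2.1 hj.2.2 with e | e
    · exact Or.inl e
    · exact Or.inr ⟨by omega, e⟩
  have him : (pk s p (n-1)).image (fun j => if j = n-1 then 0 else j-1) = vl s p (n-1) := by
    apply Finset.eq_of_subset_of_card_le
    · intro v
      simp only [Finset.mem_image]
      rintro ⟨j, hj, rfl⟩
      simp only [vl, Finset.mem_filter, Finset.mem_range]
      split_ifs with hjn
      · have := h.sne 0
        have := h.pne 0
        omega
      · have hs := (key j hj).resolve_left hjn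
        have := h.sb_data j hs
        omega
    · rw [Finset.card_image_of_injOn]
      · omega
      · intro a ha b hb hab
        have ka := key a ha
        have kb := key b hb
        have ka' : a = n-1 ∨ 2 ≤ a := ka.imp id (fun t => (h.sb_data a t).1)
        have kb' : b = n-1 ∨ 2 ≤ b := kb.imp id (fun t => (h.sb_data b t).1)
        dsimp only at hab
        split_ifs at hab <;> omega
  have hvm : v ∈ vl s p (n-1) := by
    simp only [vl, Finset.mem_filter, Finset.mem_range]; omega
  rw [← him] at hvm
  simp only [Finset.mem_image] at hvm
  obtain ⟨j, hj, hjv⟩ := hvm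
  split_ifs at hjv with hjn
  · left; omega
  · right
    have hs := (key j hj).resolve_left hjn
    have := h.sb_data j hs
    have e : v + 1 = j := by omega
    rw [e]; exact hs

theorem cross (h : PT n s p) (c : ℕ) (hc : c < n) (hsb : ¬ SBN n s p (c+1))
    (i j : ℕ) (hi : i ≤ c) (hj : j ≤ c) (hsi : c < s i) (hsj : c < s j) : i = j := by
  have h1 := h.count c hc
  have hsub : vl s p c ⊆ insert 0 ((pk s p c).image (fun j => j - 1)) := by
    intro v
    simp only [vl, pk, Finset.mem_filter, Finset.mem_range, Finset.mem_insert, Finset.mem_image]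
    intro hv
    rcases h.valley v (by omega) hv.2.1 hv.2.2 with e | e
    · exact Or.inl e
    · right
      have := h.sb_data _ e
      refine ⟨v+1, ?_, by omega⟩
      have : v ≠ c := by rintro rfl; exact hsb e
      omega
  have h2 := Finset.card_le_card hsub
  have h3 := Finset.card_insert_le 0 ((pk s p c).image (fun j => j - 1))
  have h4 : ((pk s p c).image (fun j => j - 1)).card ≤ (pk s p c).card := Finset.card_image_le
  have h5 : (up s c).card ≤ 1 := by omega
  rw [Finset.card_le_one] at h5
  apply h5 <;> simp only [up, Finset.mem_filter, Finset.mem_range] <;> omega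

theorem dcross (h : PT n s p) (c : ℕ) (hc : c < n) (hsb : ¬ SBN n s p (c+1))
    (i j : ℕ) (hi : c < i) (hj : c < j) (hsi : s i ≤ c) (hsj : s j ≤ c) : i = j := by
  have := h.inv.cross c hc (by rwa [sb_inv]) (s i) (s j) hsi hsj (by rwa [h.ps]) (by rwa [h.ps])
  rw [← h.ps i, ← h.ps j, this]

end PT

namespace PT
variable {n : ℕ} {s p : ℕ → ℕ}

theorem sb_succ (h : PT n s p) (m : ℕ) (hm : SBN n s p m) : ¬ SBN n s p (m+1) := by
  intro h2
  have a := h.sb_data _ hm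
  have b := h.sb_data _ h2
  simp only [Nat.add_sub_cancel] at b
  omega

theorem as_inv (h : PT n s p) (m : ℕ) (h1 : 1 ≤ m) (h2 : m + 2 ≤ n) :
    ASN n p s m ↔ ¬ ASN n s p m := by
  have hp := h.peak m (by omega)
  have hv := h.valley m (by omega)
  have a1 := h.sne m (by omega)
  have a2 := h.pne m (by omega)
  have a3 := h.two m (by omega)
  have b1 := h.ps m
  have b2 := h.sp m
  unfold SBN at hv
  unfold ASN
  rcases lt_or_gt_of_ne a1 with c1 | c1 <;> rcases lt_or_gt_of_ne a2 with c2 | c2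
  · grind
  · grind
  · grind
  · rcases hv c2 c1 with e | ⟨e0, e⟩
    · omega
    · rcases e with ⟨d1, d2, d3⟩ | ⟨d1, d2, d3⟩
      · have e' : s (m+1) = m := by omega
        have e2 : p m = m + 1 := by have t := h.ps (m+1); rwa [e'] at t
        rw [e'] at d3
        grind
      · have e' : p (m+1) = m := by omega
        have e2 : s m = m + 1 := by have t := h.sp (m+1); rwa [e'] at t
        rw [e'] at d1
        grind

theorem t1 (h : PT n s p) (m : ℕ) (h1 : 1 ≤ m) (h2 : m + 2 ≤ n) (hA : ASN n s p m)
    (hS : ¬ SBN n s p m) (hS' : ¬ SBN n s p (m+1)) : p m < m ∧ m < s m := by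
  have hv := h.valley m (by omega)
  have a2 := h.pne m (by omega)
  unfold SBN at hS
  unfold ASN at hA
  grind

theorem t2 (h : PT n s p) (m : ℕ) (hA : ASN n s p m)
    (hS : SBN n s p m) : p m < m ∧ s m = m - 1 ∧ m < s (m-1) ∧ p (m-1) = m ∧ ASN n s p (m-1) := by
  have hd := h.sb_data m hS
  unfold SBN at hS
  unfold ASN at hA
  have e : s m = m - 1 ∧ m < s (m-1) := by grind
  have := h.ps m
  refine ⟨hd.2.2.1, e.1, e.2, by rw [← e.1, this], by omega, Or.inl ⟨by omega, by omega⟩⟩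

theorem t3 (h : PT n s p) (m : ℕ) (hA : ASN n s p m)
    (hS : SBN n s p (m+1)) : p m = m+1 ∧ m + 1 < s m ∧ ASN n s p (m+1) := by
  have hd := h.sb_data _ hS
  unfold SBN at hS
  unfold ASN at hA ⊢
  simp only [Nat.add_sub_cancel] at hd
  have b1 := h.ps (m+1)
  have b2 := h.sp (m+1)
  obtain ⟨h0, ⟨d1, d2, d3⟩ | ⟨d1, d2, d3⟩⟩ := hS
  · have e' : s (m+1) = m := by omega
    have e2 : p m = m + 1 := by have t := h.ps (m+1); rwa [e'] at t
    rw [e'] at d3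
    grind
  · have e' : p (m+1) = m := by omega
    have e2 : s m = m + 1 := by have t := h.sp (m+1); rwa [e'] at t
    rw [e'] at d1
    grind

theorem sb_as (h : PT n s p) (m : ℕ) (hS : SBN n s p m) : ASN n s p (m-1) ↔ ASN n s p m := by
  have hd := h.sb_data m hS
  constructor
  · intro hA
    have := h.t3 (m-1) hA (by rwa [Nat.sub_add_cancel (by omega)])
    rw [Nat.sub_add_cancel (by omega)] at this
    exact this.2.2
  · intro hA
    exact (h.t2 m hA hS).2.2.2.2

theorem d1 (h : PT n s p) (m : ℕ) (h1 : 1 ≤ m) (h2 : m + 2 ≤ n) (hA : ¬ ASN n s p m)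
    (hS : ¬ SBN n s p m) (hS' : ¬ SBN n s p (m+1)) : m < p m ∧ s m < m :=
  (h.inv.t1 m h1 h2 ((h.as_inv m h1 h2).2 hA) (by rwa [sb_inv]) (by rwa [sb_inv])).symm

theorem d2 (h : PT n s p) (m : ℕ) (hA : ¬ ASN n s p m)
    (hS : SBN n s p m) : s m < m ∧ p m = m - 1 ∧ m < p (m-1) ∧ s (m-1) = m := by
  have hd := h.sb_data m hS
  have := (h.inv.t2 m ((h.as_inv m (by omega) (by omega)).2 hA) (by rwa [sb_inv]))
  exact ⟨this.1, this.2.1, this.2.2.1, this.2.2.2.1⟩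

theorem d3 (h : PT n s p) (m : ℕ) (hA : ¬ ASN n s p m)
    (hS : SBN n s p (m+1)) : s m = m+1 ∧ m + 1 < p m := by
  have hd := h.sb_data _ hS
  have := (h.inv.t3 m ((h.as_inv m (by omega) (by omega)).2 hA) (by rwa [sb_inv]))
  exact ⟨this.1, this.2.1⟩

/-- exits of ascending blocks -/
def UE (n : ℕ) (s p : ℕ → ℕ) (e : ℕ) : Prop := e = 0 ∨ (ASN n s p e ∧ ¬ SBN n s p e)

/-- exits of descending blocks -/
def DE (n : ℕ) (s p : ℕ → ℕ) (e : ℕ) : Prop :=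
  e = n - 1 ∨ (1 ≤ e ∧ e + 2 ≤ n ∧ ¬ ASN n s p e ∧ ¬ SBN n s p (e+1))

theorem zero_facts (h : PT n s p) : 0 < s 0 ∧ 0 < p 0 ∧ ¬ SBN n s p 0 ∧ ¬ SBN n s p 1 := by
  have h4 := h.hn
  have a := h.sne 0
  have b := h.pne 0
  refine ⟨by omega, by omega, fun t => ?_, fun t => ?_⟩ <;> have := h.sb_data _ t <;> omega

theorem last_facts (h : PT n s p) : s (n-1) < n-1 ∧ p (n-1) < n - 1 ∧ ¬ SBN n s p n := by
  have h4 := h.hn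
  have a := h.sne (n-1)
  have b := h.pne (n-1)
  have c := h.slt (n-1)
  have d := h.plt (n-1)
  refine ⟨by omega, by omega, fun t => ?_⟩
  have := h.sb_data _ t; omega

theorem as_last (h : PT n s p) : ¬ ASN n s p (n-1) := by
  have h4 := h.hn
  have := h.last_facts
  have := h.slt _ (h.slt (n-1) (by omega))
  unfold ASN
  omega

theorem ue_up (h : PT n s p) (e : ℕ) (he : UE n s p e) : e < s e := by
  rcases he with rfl | ⟨hA, hS⟩
  · exact h.zero_facts.1
  · unfold SBN at hS
    unfold ASN at hA
    tauto

theorem ue_of (h : PT n s p) (e : ℕ) (h0 : e < n) (he : e < s e) (hb : ¬ (s e = e + 1 ∧ SBN n s p (e+1))) :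
    UE n s p e := by
  by_cases h1 : e = 0
  · exact Or.inl h1
  have hn2 : e + 2 ≤ n := by have := h.slt e h0; omega
  have hS : ¬ SBN n s p e := fun t => by have := h.sb_data e t; omega
  refine Or.inr ⟨?_, hS⟩
  by_contra hA
  by_cases hS' : SBN n s p (e+1)
  · exact hb ⟨(h.d3 e hA hS').1, hS'⟩
  · have := h.d1 e (by omega) hn2 hA hS hS'
    omega

/-- predecessor of an ascending entry -/
theorem asc_pred (h : PT n s p) (i c : ℕ) (hi : i < n) (hc : (c + 1 = i ∧ ¬ SBN n s p i) ∨
      (c + 2 = i ∧ SBN n s p i)) (hpi : i = n - 1 ∨ (ASN n s p i ∧ ¬ SBN n s p (i+1))) :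
    p i ≤ c ∧ UE n s p (p i) ∧ ∀ m, m ≤ c → UE n s p m → m ≤ p i := by
  have h4 := h.hn
  have hsp := h.sp i
  have hpn := h.plt i hi
  have hcs : ¬ SBN n s p (c+1) := by
    rcases hc with ⟨e, hS⟩ | ⟨e, hS⟩
    · rwa [e]
    · intro t
      exact h.sb_succ _ t (by rwa [show c + 1 + 1 = i by omega])
  have hpc : p i ≤ c := by
    rcases hpi with e | ⟨hA, hS'⟩
    · have := h.not_last
      have := h.last_facts
      rw [← e] at *
      rcases hc with ⟨e, hS⟩ | ⟨e, hS⟩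
      · omega
      · contradiction
    · have hi2 : i ≠ n - 1 := by rintro rfl; exact h.as_last hA
      rcases hc with ⟨e, hS⟩ | ⟨e, hS⟩
      · have := h.t1 i (by unfold ASN at hA; omega) (by omega) hA hS hS'
        omega
      · have := h.t2 i hA hS
        have := h.two i hi
        omega
  have hue : UE n s p (p i) := by
    apply h.ue_of _ hpn (by omega)
    rw [hsp]
    rintro ⟨e, hS⟩
    rcases hc with ⟨e', hS'⟩ | ⟨e', hS'⟩
    · rw [← e] at hS; contradiction
    · omega
  refine ⟨hpc, hue, ?_⟩
  -- downward induction on `m`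
  suffices H : ∀ d m, m + d = c → UE n s p m → m ≤ p i from
    fun m hm hu => H (c - m) m (by omega) hu
  intro d
  induction d using Nat.strong_induction_on with
  | _ d ih =>
    intro m hm hu
    by_contra hlt
    have hup := h.ue_up m hu
    have hpsm := h.ps m
    by_cases hcm : c < s m
    · have := h.cross c (by omega) hcs m (p i) (by omega) hpc hcm (by omega)
      omega
    · have hup' := h.sne (s m) (by omega)
      have htwo := h.two (s m) (by omega)
      rcases lt_or_gt_of_ne hup' with q | q
      · -- `s m` is a peak
        have hS : SBN n s p (s m) := by
          rcases h.peak (s m) (by omega) (by omega) q with e | e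
          · omega
          · exact ⟨by omega, e⟩
        have hA : ASN n s p (s m) := by
          by_contra hA
          have a := h.d2 _ hA hS
          have b := h.sb_as _ hS
          have c := h.sb_data _ hS
          rcases hu with rfl | ⟨hu1, _⟩
          · omega
          · apply hA
            rw [← b, ← a.2.1, hpsm]
            exact hu1
        have a := h.t2 _ hA hS
        have := ih (c - (s m - 1)) (by omega) (s m - 1) (by omega)
          (Or.inr ⟨a.2.2.2.2, fun t => h.sb_succ _ t (by rwa [Nat.sub_add_cancel (by omega)])⟩)
        omega
      · have := ih (c - s m) (by omega) (s m) (by omega) (by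
          apply h.ue_of _ (by omega) q
          rintro ⟨e, hS⟩
          have a := h.sb_data _ hS
          simp only [Nat.add_sub_cancel] at a
          omega)
        omega

theorem de_down (h : PT n s p) (e : ℕ) (he : DE n s p e) : s e < e := by
  rcases he with rfl | ⟨h1, h2, hA, hS'⟩
  · exact h.last_facts.1
  · by_cases hS : SBN n s p e
    · exact (h.d2 e hA hS).1
    · exact (h.d1 e h1 h2 hA hS hS').2

theorem de_of (h : PT n s p) (e : ℕ) (h0 : e < n) (he : s e < e)
    (hb : ¬ (s e + 1 = e ∧ SBN n s p e)) : DE n s p e := by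
  by_cases h1 : e = n - 1
  · exact Or.inl h1
  have hn1 : 1 ≤ e := by omega
  have hS : ¬ SBN n s p (e+1) := fun t => by
    have := h.sb_data _ t
    simp only [Nat.add_sub_cancel] at this
    omega
  refine Or.inr ⟨hn1, by omega, ?_, hS⟩
  intro hA
  by_cases hS' : SBN n s p e
  · have := h.t2 e hA hS'
    exact hb ⟨by omega, hS'⟩
  · have := h.t1 e (by omega) (by omega) hA hS' hS
    omega

/-- predecessor of a descending entry -/
theorem desc_pred (h : PT n s p) (i c : ℕ) (hi : i + 1 < n) (hc : (c = i ∧ ¬ SBN n s p (i+1)) ∨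
      (c = i + 1 ∧ SBN n s p (i+1))) (hpi : i = 0 ∨ (¬ ASN n s p i ∧ ¬ SBN n s p i)) :
    c < p i ∧ DE n s p (p i) ∧ ∀ m, c < m → DE n s p m → p i ≤ m := by
  have h4 := h.hn
  have hsp := h.sp i
  have hpn := h.plt i (by omega)
  have hcn : c + 1 < n := by
    rcases hc with ⟨e, _⟩ | ⟨e, hS⟩
    · omega
    · have := h.sb_data _ hS; omega
  have hcs : ¬ SBN n s p (c+1) := by
    rcases hc with ⟨e, hS⟩ | ⟨e, hS⟩
    · rwa [e]
    · rw [e]; exact h.sb_succ _ hS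
  have hpc : c < p i := by
    have hz := h.zero_facts
    rcases hpi with rfl | ⟨hA, hS'⟩
    · rcases hc with ⟨e, hS⟩ | ⟨e, hS⟩
      · omega
      · exact absurd hS hz.2.2.2
    · rcases hc with ⟨e, hS⟩ | ⟨e, hS⟩
      · by_cases h0 : i = 0
        · subst h0; omega
        have := h.d1 i (by omega) (by omega) hA hS' hS
        omega
      · have := h.d3 i hA hS
        omega
  have hde : DE n s p (p i) := by
    apply h.de_of _ hpn (by omega)
    rw [hsp]
    rintro ⟨e, hS⟩
    rw [← e] at hS
    rcases hc with ⟨e', hS'⟩ | ⟨e', hS'⟩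
    · contradiction
    · omega
  refine ⟨hpc, hde, ?_⟩
  intro m
  induction m using Nat.strong_induction_on with
  | _ m ih =>
    intro hm hu
    by_contra hlt
    have hdn := h.de_down m hu
    have hpsm := h.ps m
    by_cases hcm : s m ≤ c
    · have := h.dcross c (by omega) hcs m (p i) (by omega) hpc hcm (by omega)
      omega
    · have hup' := h.sne (s m) (by omega)
      have htwo := h.two (s m) (by omega)
      rcases lt_or_gt_of_ne hup' with q | q
      · have := ih (s m) (by omega) (by omega) (by
          apply h.de_of _ (by omega) q
          rintro ⟨e, hS⟩
          have a := h.sb_data _ hS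
          omega)
        omega
      · -- `s m` is a valley
        have hS : SBN n s p (s m + 1) :=
          (h.valley (s m) (by omega) (by omega) q).resolve_left (by omega)
        have hmn : m ≠ n - 1 := by omega
        have hA : ¬ ASN n s p (s m) := by
          intro hA
          have a := h.t3 _ hA hS
          rcases hu with rfl | ⟨_, _, hu1, _⟩
          · omega
          · apply hu1
            rw [← hpsm, a.1]
            exact a.2.2
        have a := h.d3 _ hA hS
        have b := h.sb_as _ hS
        simp only [Nat.add_sub_cancel] at b
        have c := h.sb_data _ hS
        have := ih (s m + 1) (by omega) (by omega)
          (Or.inr ⟨by omega, by omega, fun t => hA (b.2 t), h.sb_succ _ hS⟩)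
        omega

end PT

namespace PT
variable {n : ℕ} {s p s' p' : ℕ → ℕ}

theorem asc_eq (h : PT n s p) (h' : PT n s' p') (i c d : ℕ) (hi : i < n)
    (hc : (c + 1 = i ∧ ¬ SBN n s p i) ∨ (c + 2 = i ∧ SBN n s p i))
    (hpi : i = n - 1 ∨ (ASN n s p i ∧ ¬ SBN n s p (i+1)))
    (hc' : (c + 1 = i ∧ ¬ SBN n s' p' i) ∨ (c + 2 = i ∧ SBN n s' p' i))
    (hpi' : i = n - 1 ∨ (ASN n s' p' i ∧ ¬ SBN n s' p' (i+1)))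
    (hd : d ≤ c) (hud : UE n s p d) (hud' : UE n s' p' d)
    (hag : ∀ m, d ≤ m → m ≤ c → (UE n s p m ↔ UE n s' p' m)) : p i = p' i := by
  obtain ⟨a1, a2, a3⟩ := h.asc_pred i c hi hc hpi
  obtain ⟨b1, b2, b3⟩ := h'.asc_pred i c hi hc' hpi'
  have a4 := a3 d hd hud
  have b4 := b3 d hd hud'
  have a5 := a3 (p' i) b1 ((hag _ b4 b1).2 b2)
  have b5 := b3 (p i) a1 ((hag _ a4 a1).1 a2)
  omega

theorem desc_eq (h : PT n s p) (h' : PT n s' p') (i c d : ℕ) (hi : i + 1 < n)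
    (hc : (c = i ∧ ¬ SBN n s p (i+1)) ∨ (c = i + 1 ∧ SBN n s p (i+1)))
    (hpi : i = 0 ∨ (¬ ASN n s p i ∧ ¬ SBN n s p i))
    (hc' : (c = i ∧ ¬ SBN n s' p' (i+1)) ∨ (c = i + 1 ∧ SBN n s' p' (i+1)))
    (hpi' : i = 0 ∨ (¬ ASN n s' p' i ∧ ¬ SBN n s' p' i))
    (hd : c < d) (hud : DE n s p d) (hud' : DE n s' p' d)
    (hag : ∀ m, c < m → m ≤ d → (DE n s p m ↔ DE n s' p' m)) : p i = p' i := by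
  obtain ⟨a1, a2, a3⟩ := h.desc_pred i c hi hc hpi
  obtain ⟨b1, b2, b3⟩ := h'.desc_pred i c hi hc' hpi'
  have a4 := a3 d hd hud
  have b4 := b3 d hd hud'
  have a5 := a3 (p' i) b1 ((hag _ b1 b4).2 b2)
  have b5 := b3 (p i) a1 ((hag _ a1 a4).1 a2)
  omega

/-- the segment `(k,k+1)` is ascending/descending, so `k+1` is not a step-back peak -/
theorem no_sb (h : PT n s p) (k : ℕ) (hA : ASN n s p k) (hD : ¬ ASN n s p (k+1)) :
    ¬ SBN n s p (k+1) := by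
  intro hS
  have := h.sb_as _ hS
  simp only [Nat.add_sub_cancel] at this
  exact hD (this.1 hA)

theorem left_eq (h : PT n s p) (h' : PT n s' p') (k : ℕ) (hk : 1 ≤ k) (hk2 : k + 3 ≤ n)
    (hA : ASN n s p k) (hD : ¬ ASN n s p (k+1))
    (hD' : ¬ ASN n s' p' (k+1))
    (hS2 : SBN n s p (k+2) ↔ SBN n s' p' (k+2))
    (hAS : ∀ m, 1 ≤ m → m ≤ k → (ASN n s p m ↔ ASN n s' p' m) ∧ (SBN n s p m ↔ SBN n s' p' m))
    (i : ℕ) (hi : i ≤ k) : p i = p' i := by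
  have hN := h.no_sb k hA hD
  have hN' := h'.no_sb k ((hAS k hk le_rfl).1.1 hA) hD'
  have hz := h.zero_facts
  have hz' := h'.zero_facts
  have hS : ∀ m, m ≤ k + 2 → (SBN n s p m ↔ SBN n s' p' m) := by
    intro m hm
    by_cases m0 : m = 0
    · subst m0; exact iff_of_false hz.2.2.1 hz'.2.2.1
    by_cases m1 : m = k + 1
    · subst m1; exact iff_of_false hN hN'
    by_cases m2 : m = k + 2
    · subst m2; exact hS2
    exact (hAS m (by omega) (by omega)).2
  have hAA : ∀ m, 1 ≤ m → m ≤ k + 1 → (ASN n s p m ↔ ASN n s' p' m) := by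
    intro m h1 hm
    by_cases m1 : m = k + 1
    · subst m1; exact iff_of_false hD hD'
    exact (hAS m (by omega) (by omega)).1
  have hUE : ∀ m, m ≤ k → (UE n s p m ↔ UE n s' p' m) := by
    intro m hm
    unfold UE
    by_cases m0 : m = 0
    · simp [m0]
    rw [hAA m (by omega) (by omega), hS m (by omega)]
  have hDE : ∀ m, m ≤ k + 1 → (DE n s p m ↔ DE n s' p' m) := by
    intro m hm
    unfold DE
    by_cases m0 : m = 0
    · simp [m0]
    rw [hAA m (by omega) (by omega), hS (m+1) (by omega)]
  by_cases hdesc : i = 0 ∨ (¬ ASN n s p i ∧ ¬ SBN n s p i)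
  · have hdesc' : i = 0 ∨ (¬ ASN n s' p' i ∧ ¬ SBN n s' p' i) := by
      rcases hdesc with e | e
      · exact Or.inl e
      · by_cases i0 : i = 0
        · exact Or.inl i0
        · rw [hAA i (by omega) (by omega), hS i (by omega)] at e; exact Or.inr e
    obtain ⟨c, hck, hc⟩ : ∃ c, c ≤ k ∧ ((c = i ∧ ¬ SBN n s p (i+1)) ∨ (c = i + 1 ∧ SBN n s p (i+1))) := by
      by_cases t : SBN n s p (i+1)
      · have : i ≠ k := by rintro rfl; exact hN t
        exact ⟨i+1, by omega, Or.inr ⟨rfl, t⟩⟩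
      · exact ⟨i, hi, Or.inl ⟨rfl, t⟩⟩
    have hc' := hc
    rw [hS (i+1) (by omega)] at hc'
    by_cases t : SBN n s p (k+2)
    · have t' := hS2.1 t
      have td := h.sb_data _ t
      have u := h.sb_as _ t
      have u' := h'.sb_as _ t'
      simp only [show k + 2 - 1 = k + 1 by omega] at u u'
      have v : DE n s p (k+2) := Or.inr ⟨by omega, by omega, fun q => hD (u.2 q), h.sb_succ _ t⟩
      have v' : DE n s' p' (k+2) :=
        Or.inr ⟨by omega, by omega, fun q => hD' (u'.2 q), h'.sb_succ _ t'⟩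
      refine h.desc_eq h' i c (k+2) (by omega) hc hdesc hc' hdesc' (by omega) v v' ?_
      intro m h1 h2
      by_cases m2 : m = k + 2
      · subst m2; exact iff_of_true v v'
      · exact hDE m (by omega)
    · have t' : ¬ SBN n s' p' (k+2) := fun q => t (hS2.2 q)
      exact h.desc_eq h' i c (k+1) (by omega) hc hdesc hc' hdesc' (by omega)
        (Or.inr ⟨by omega, by omega, hD, t⟩) (Or.inr ⟨by omega, by omega, hD', t'⟩)
        (fun m _ h2 => hDE m h2)
  · have i0 : 1 ≤ i := by omega
    by_cases hAi : ASN n s p i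
    · have hAi' := (hAA i i0 (by omega)).1 hAi
      by_cases t : SBN n s p (i+1)
      · rw [(h.t3 i hAi t).1, (h'.t3 i hAi' ((hS _ (by omega)).1 t)).1]
      · obtain ⟨c, hci, hc⟩ : ∃ c, c < i ∧ ((c + 1 = i ∧ ¬ SBN n s p i) ∨ (c + 2 = i ∧ SBN n s p i)) := by
          by_cases t : SBN n s p i
          · have := h.sb_data _ t
            exact ⟨i-2, by omega, Or.inr ⟨by omega, t⟩⟩
          · exact ⟨i-1, by omega, Or.inl ⟨by omega, t⟩⟩
        have hc' := hc
        rw [hS i (by omega)] at hc'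
        have t' : ¬ SBN n s' p' (i+1) := fun q => t ((hS _ (by omega)).2 q)
        exact h.asc_eq h' i c 0 (by omega) hc (Or.inr ⟨hAi, t⟩) hc' (Or.inr ⟨hAi', t'⟩)
          (by omega) (Or.inl rfl) (Or.inl rfl) (fun m _ hm => hUE m (by omega))
    · have hAi' : ¬ ASN n s' p' i := fun q => hAi ((hAA i i0 (by omega)).2 q)
      have hSi : SBN n s p i := by tauto
      rw [(h.d2 i hAi hSi).2.1, (h'.d2 i hAi' ((hS _ (by omega)).1 hSi)).2.1]

theorem right_eq (h : PT n s p) (h' : PT n s' p') (k : ℕ) (hk : 1 ≤ k) (hk2 : k + 3 ≤ n)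
    (hA : ASN n s p k) (hD : ¬ ASN n s p (k+1))
    (hA' : ASN n s' p' k)
    (hS0 : SBN n s p k ↔ SBN n s' p' k)
    (hAS : ∀ m, k + 1 ≤ m → m ≤ n - 2 →
      (ASN n s p m ↔ ASN n s' p' m) ∧ (SBN n s p m ↔ SBN n s' p' m))
    (i : ℕ) (hi : k + 1 ≤ i) (hin : i < n) : p i = p' i := by
  have hD' : ¬ ASN n s' p' (k+1) := fun q => hD ((hAS (k+1) le_rfl (by omega)).1.2 q)
  have hN := h.no_sb k hA hD
  have hN' := h'.no_sb k hA' hD'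
  have hz := h.last_facts
  have hz' := h'.last_facts
  have hl := h.not_last
  have hl' := h'.not_last
  have hS : ∀ m, k ≤ m → m ≤ n → (SBN n s p m ↔ SBN n s' p' m) := by
    intro m hm hm2
    by_cases m0 : m = n
    · subst m0; exact iff_of_false hz.2.2 hz'.2.2
    by_cases m1 : m = n - 1
    · subst m1; exact iff_of_false hl hl'
    by_cases m2 : m = k
    · subst m2; exact hS0
    exact (hAS m (by omega) (by omega)).2
  have hAA : ∀ m, k ≤ m → m ≤ n - 1 → (ASN n s p m ↔ ASN n s' p' m) := by
    intro m h1 hm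
    by_cases m1 : m = k
    · subst m1; exact iff_of_true hA hA'
    by_cases m2 : m = n - 1
    · subst m2; exact iff_of_false h.as_last h'.as_last
    exact (hAS m (by omega) (by omega)).1
  have hUE : ∀ m, k ≤ m → m ≤ n - 1 → (UE n s p m ↔ UE n s' p' m) := by
    intro m hm hm2
    unfold UE
    rw [hAA m (by omega) (by omega), hS m (by omega) (by omega)]
  have hDE : ∀ m, k ≤ m → m ≤ n - 1 → (DE n s p m ↔ DE n s' p' m) := by
    intro m hm hm2
    unfold DE
    rw [hAA m (by omega) (by omega), hS (m+1) (by omega) (by omega)]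
  by_cases hasc : i = n - 1 ∨ (ASN n s p i ∧ ¬ SBN n s p (i+1))
  · have hasc' := hasc
    rw [hAA i (by omega) (by omega), hS (i+1) (by omega) (by omega)] at hasc'
    have hik : i ≠ k + 1 := by
      rintro rfl
      rcases hasc with e | e
      · omega
      · exact hD e.1
    obtain ⟨c, hck, hci, hc⟩ : ∃ c, k + 1 ≤ c ∧ c < i ∧
        ((c + 1 = i ∧ ¬ SBN n s p i) ∨ (c + 2 = i ∧ SBN n s p i)) := by
      by_cases t : SBN n s p i
      · have hAi : ASN n s p i := by
          rcases hasc with e | e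
          · rw [e] at t; exact absurd t hl
          · exact e.1
        have u := (h.sb_as i t).2 hAi
        have : i ≠ k + 2 := by rintro rfl; exact hD u
        exact ⟨i-2, by omega, by omega, Or.inr ⟨by omega, t⟩⟩
      · exact ⟨i-1, by omega, by omega, Or.inl ⟨by omega, t⟩⟩
    have hc' := hc
    rw [hS i (by omega) (by omega)] at hc'
    by_cases t : SBN n s p k
    · have t' := hS0.1 t
      have u := (h.sb_as _ t).2 hA
      have u' := (h'.sb_as _ t').2 hA'
      have v : UE n s p (k-1) :=
        Or.inr ⟨u, fun q => h.sb_succ _ q (by rwa [Nat.sub_add_cancel hk])⟩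
      have v' : UE n s' p' (k-1) :=
        Or.inr ⟨u', fun q => h'.sb_succ _ q (by rwa [Nat.sub_add_cancel hk])⟩
      refine h.asc_eq h' i c (k-1) (by omega) hc hasc hc' hasc' (by omega) v v' ?_
      intro m h1 h2
      by_cases m2 : m = k - 1
      · subst m2; exact iff_of_true v v'
      · exact hUE m (by omega) (by omega)
    · have t' : ¬ SBN n s' p' k := fun q => t (hS0.2 q)
      exact h.asc_eq h' i c k (by omega) hc hasc hc' hasc' (by omega)
        (Or.inr ⟨hA, t⟩) (Or.inr ⟨hA', t'⟩)
        (fun m h1 h2 => hUE m h1 (by omega))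
  · by_cases hAi : ASN n s p i
    · have hAi' := (hAA i (by omega) (by omega)).1 hAi
      have t : SBN n s p (i+1) := by tauto
      rw [(h.t3 i hAi t).1, (h'.t3 i hAi' ((hS _ (by omega) (by omega)).1 t)).1]
    · have hAi' : ¬ ASN n s' p' i := fun q => hAi ((hAA i (by omega) (by omega)).2 q)
      by_cases hSi : SBN n s p i
      · rw [(h.d2 i hAi hSi).2.1, (h'.d2 i hAi' ((hS _ (by omega) (by omega)).1 hSi)).2.1]
      · have hSi' : ¬ SBN n s' p' i := fun q => hSi ((hS _ (by omega) (by omega)).2 q)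
        obtain ⟨c, hck, hcn, hc⟩ : ∃ c, k + 1 ≤ c ∧ c < n - 1 ∧
            ((c = i ∧ ¬ SBN n s p (i+1)) ∨ (c = i + 1 ∧ SBN n s p (i+1))) := by
          by_cases t : SBN n s p (i+1)
          · have := h.sb_data _ t
            exact ⟨i+1, by omega, by omega, Or.inr ⟨rfl, t⟩⟩
          · exact ⟨i, hi, by omega, Or.inl ⟨rfl, t⟩⟩
        have hc' := hc
        rw [hS (i+1) (by omega) (by omega)] at hc'
        exact h.desc_eq h' i c (n-1) (by omega) hc (Or.inr ⟨hAi, hSi⟩) hc' (Or.inr ⟨hAi', hSi'⟩)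
          (by omega) (Or.inl rfl) (Or.inl rfl) (fun m h1 h2 => hDE m (by omega) h2)

end PT

section Bridge
variable {n : ℕ}

/-- a permutation of `Fin n` as a function on naturals -/
def sN (τ : Equiv.Perm (Fin n)) (m : ℕ) : ℕ := if h : m < n then (τ ⟨m, h⟩ : ℕ) else m

theorem sN_val (τ : Equiv.Perm (Fin n)) (i : Fin n) : sN τ (i : ℕ) = (τ i : ℕ) := by
  simp [sN]

theorem sN_inv (τ : Equiv.Perm (Fin n)) (m : ℕ) : sN τ (sN τ⁻¹ m) = m := by
  by_cases h : m < n
  · have e := sN_val τ⁻¹ ⟨m, h⟩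
    simp only at e
    rw [e, sN_val]
    simp
  · simp [sN, h]

theorem perm_inv_self (τ : Equiv.Perm (Fin n)) (i : Fin n) : τ⁻¹ (τ i) = i := by simp

theorem perm_inv_iff (τ : Equiv.Perm (Fin n)) (i j : Fin n) : τ⁻¹ j = i ↔ τ i = j := by
  rw [Equiv.Perm.inv_eq_iff_eq, eq_comm]

theorem tour_fix (hn : 4 ≤ n) (τ : Equiv.Perm (Fin n)) (hτ : IsTour τ) (i : Fin n) :
    τ i ≠ τ⁻¹ i := by
  intro e
  have e2 : τ (τ i) = i := by rw [e]; simp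
  have H : ∀ k : ℕ, (τ ^ k) i = i ∨ (τ ^ k) i = τ i := by
    intro k
    induction k with
    | zero => left; simp
    | succ k ih =>
      rw [pow_succ', Equiv.Perm.mul_apply]
      rcases ih with h | h <;> rw [h]
      · right; rfl
      · left; exact e2
  have H2 : (Finset.univ : Finset (Fin n)) ⊆ {i, τ i} := by
    intro j _
    obtain ⟨k, hk⟩ := hτ i j
    have := H k
    rw [hk] at this
    simpa using this
  have := Finset.card_le_card H2
  have h2 : ({i, τ i} : Finset (Fin n)).card ≤ 2 := Finset.card_le_two
  simp at this
  omega

theorem tour_ne (hn : 4 ≤ n) (τ : Equiv.Perm (Fin n)) (hτ : IsTour τ) (i : Fin n) :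
    τ i ≠ i := by
  intro e
  apply tour_fix hn τ hτ i
  rw [e, Equiv.Perm.eq_inv_iff_eq, e]

theorem sb_bridge (τ : Equiv.Perm (Fin n)) (i : Fin n) :
    IsStepBackPeak τ i ↔ SBN n (sN τ) (sN τ⁻¹) (i : ℕ) := by
  simp only [IsStepBackPeak, SBN, sN_val, Fin.lt_def, i.isLt, true_and]

theorem as_bridge (τ : Equiv.Perm (Fin n)) (i : Fin n) :
    Ascends τ i ↔ ASN n (sN τ) (sN τ⁻¹) (i : ℕ) := by
  simp only [Ascends, ASN, sN_val, Fin.lt_def, i.isLt, true_and]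

theorem sbAt_bridge (τ : Equiv.Perm (Fin n)) (m : ℕ) :
    SBPeakAt τ m ↔ SBN n (sN τ) (sN τ⁻¹) m := by
  constructor
  · rintro ⟨i, rfl, h⟩; exact (sb_bridge τ i).1 h
  · intro h; exact ⟨⟨m, h.1⟩, rfl, (sb_bridge τ ⟨m, h.1⟩).2 h⟩

theorem asAt_bridge (τ : Equiv.Perm (Fin n)) (m : ℕ) :
    AscAt τ m ↔ ASN n (sN τ) (sN τ⁻¹) m := by
  constructor
  · rintro ⟨i, rfl, h⟩; exact (as_bridge τ i).1 h
  · intro h; exact ⟨⟨m, h.1⟩, rfl, (as_bridge τ ⟨m, h.1⟩).2 h⟩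

theorem toPT (hn : 4 ≤ n) (τ : Equiv.Perm (Fin n)) (hτ : IsPSB τ) :
    PT n (sN τ) (sN τ⁻¹) where
  hn := hn
  sp := sN_inv τ
  ps := fun m => by simpa using sN_inv τ⁻¹ m
  slt := fun m hm => by simp [sN, hm]
  plt := fun m hm => by simp [sN, hm]
  sne := fun m hm e => by
    have := sN_val τ ⟨m, hm⟩
    simp only at this
    rw [this] at e
    exact tour_ne hn τ hτ.1 ⟨m, hm⟩ (Fin.ext e)
  two := fun m hm e => by
    have h1 := sN_val τ ⟨m, hm⟩
    have h2 := sN_val τ⁻¹ ⟨m, hm⟩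
    simp only at h1 h2
    rw [h1, h2] at e
    exact tour_fix hn τ hτ.1 ⟨m, hm⟩ (Fin.ext e)
  peak := fun m hm a b => by
    by_contra hcon
    rw [not_or] at hcon
    apply hcon.1
    refine (hτ.2 ⟨m, hm⟩).1 ⟨?_, ?_⟩
    · have h1 := sN_val τ ⟨m, hm⟩
      have h2 := sN_val τ⁻¹ ⟨m, hm⟩
      simp only at h1 h2
      rw [h2] at a
      rw [h1] at b
      exact ⟨a, b⟩
    · rw [sb_bridge]
      rintro ⟨_, h⟩
      exact hcon.2 h

theorem reach (τ σ : Equiv.Perm (Fin n)) (hτ : IsTour τ) (P : Fin n → Prop) (a : Fin n)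
    (hP : ∀ i, P i → i ≠ a → P (τ i) ∧ σ i = τ i) (i : Fin n) (hi : P i) :
    σ.SameCycle i a := by
  obtain ⟨m, hm⟩ := hτ i a
  induction m generalizing i with
  | zero => simp at hm; rw [hm]
  | succ m ih =>
    by_cases e : i = a
    · rw [e]
    · obtain ⟨h1, h2⟩ := hP i hi e
      have := ih (τ i) h1 (by rw [← hm, pow_succ, Equiv.Perm.mul_apply])
      rw [← h2] at this
      exact (Equiv.Perm.sameCycle_apply_left).1 this

theorem exists_exit (τ : Equiv.Perm (Fin n)) (hτ : IsTour τ) (P : Fin n → Prop)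
    (i j : Fin n) (hi : P i) (hj : ¬ P j) : ∃ a, P a ∧ ¬ P (τ a) := by
  by_contra hcon
  push Not at hcon
  obtain ⟨m, hm⟩ := hτ i j
  apply hj
  rw [← hm]
  clear hm
  induction m with
  | zero => simpa using hi
  | succ m ih => rw [pow_succ', Equiv.Perm.mul_apply]; exact hcon _ ih

theorem psb_inv (τ : Equiv.Perm (Fin n)) (h : IsPSB τ) : IsPSB τ⁻¹ := by
  refine ⟨fun i j => ?_, fun i => ?_⟩
  · obtain ⟨k, hk⟩ := h.1 j i
    refine ⟨k, ?_⟩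
    rw [← hk, inv_pow]; simp
  · rw [← h.2 i]
    simp only [IsPeak, IsStepBackPeak, inv_inv]
    tauto

theorem core (hn : 4 ≤ n) (x y z : Equiv.Perm (Fin n))
    (hx : IsPSB x) (hy : IsPSB y) (hz : IsPSB z) (k : ℕ) (hk2 : k + 3 ≤ n)
    (hSy : ¬ SBN n (sN y) (sN y⁻¹) (k+1)) (hSz : ¬ SBN n (sN z) (sN z⁻¹) (k+1))
    (HA : ∀ i : Fin n, (i : ℕ) ≤ k → x⁻¹ i = y⁻¹ i)
    (HB : ∀ i : Fin n, k < (i : ℕ) → x⁻¹ i = z⁻¹ i) :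
    ∃ w : Equiv.Perm (Fin n), IsPSB w ∧ chv y + chv z = chv x + chv w := by
  set w : Equiv.Perm (Fin n) := y * x⁻¹ * z with hw
  have wL : ∀ i : Fin n, (i : ℕ) ≤ k → w⁻¹ i = z⁻¹ i := by
    intro i hi
    simp only [hw, mul_inv_rev, inv_inv, Equiv.Perm.mul_apply]
    rw [← HA i hi]; simp
  have wR : ∀ i : Fin n, k < (i : ℕ) → w⁻¹ i = y⁻¹ i := by
    intro i hi
    simp only [hw, mul_inv_rev, inv_inv, Equiv.Perm.mul_apply]
    have hj : k < (x (y⁻¹ i) : ℕ) := by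
      by_contra hcon
      have := HA (x (y⁻¹ i)) (by omega)
      simp only [perm_inv_self] at this
      have := y⁻¹.injective this
      rw [← this] at hcon
      exact hcon hi
    rw [← HB _ hj]; simp
  have wF : ∀ i : Fin n, ((w i : ℕ) ≤ k ∧ z i = w i ∧ (y i : ℕ) ≤ k) ∨
      (k < (w i : ℕ) ∧ y i = w i ∧ k < (z i : ℕ)) := by
    intro i
    by_cases h : (w i : ℕ) ≤ k
    · left
      have e := wL _ h
      simp only [perm_inv_self] at e
      refine ⟨h, by conv_lhs => rw [e]
                    simp, ?_⟩
      by_contra hcon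
      have e' := wR (y i) (by omega)
      simp only [perm_inv_self] at e'
      rw [Equiv.Perm.inv_eq_iff_eq] at e'
      rw [← e'] at h; omega
    · right
      have e := wR (w i) (by omega)
      simp only [perm_inv_self] at e
      refine ⟨by omega, by conv_lhs => rw [e]
                           simp, ?_⟩
      by_contra hcon
      have e' := wL (z i) (by omega)
      simp only [perm_inv_self] at e'
      rw [Equiv.Perm.inv_eq_iff_eq] at e'
      rw [← e'] at h; omega
  have py := toPT hn y hy
  have pz := toPT hn z hz
  have tw : IsTour w := by
    obtain ⟨a, ha, ha'⟩ := exists_exit z hz.1 (fun i => (i : ℕ) ≤ k) ⟨0, by omega⟩ ⟨n-1, by omega⟩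
      (by simp) (by simp; omega)
    obtain ⟨b, hb, hb'⟩ := exists_exit y hy.1 (fun i => k < (i : ℕ)) ⟨n-1, by omega⟩ ⟨0, by omega⟩
      (by simp; omega) (by simp)
    have rL := reach z w hz.1 (fun i => (i : ℕ) ≤ k) a (by
      intro i hi hia
      have : (z i : ℕ) ≤ k := by
        by_contra hcon
        apply hia
        apply Fin.ext
        exact pz.cross k (by omega) hSz i a hi ha (by rw [sN_val]; omega) (by rw [sN_val]; omega)
      refine ⟨this, ?_⟩
      rcases wF i with q | q
      · exact q.2.1.symm
      · omega)
    have rR := reach y w hy.1 (fun i => k < (i : ℕ)) b (by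
      intro i hi hib
      have : k < (y i : ℕ) := by
        by_contra hcon
        apply hib
        apply Fin.ext
        exact py.dcross k (by omega) hSy i b hi hb (by rw [sN_val]; omega) (by rw [sN_val]; omega)
      refine ⟨this, ?_⟩
      rcases wF i with q | q
      · omega
      · exact q.2.1.symm)
    have hwa : k < (w a : ℕ) := by
      rcases wF a with q | q
      · rw [q.2.1] at ha'; omega
      · exact q.1
    have hab : w.SameCycle a b := (Equiv.Perm.sameCycle_apply_left).1 (rR (w a) hwa)
    have hall : ∀ i, w.SameCycle i b := by
      intro i
      by_cases h : (i : ℕ) ≤ k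
      · exact (rL i h).trans hab
      · exact rR i (by omega)
    intro i j
    obtain ⟨m, _, hm⟩ := ((hall i).trans (hall j).symm).exists_pow_eq'
    exact ⟨m, hm⟩
  refine ⟨w, ⟨tw, ?_⟩, ?_⟩
  · intro i
    constructor
    · rintro ⟨⟨p1, p2⟩, p3⟩
      by_contra hin
      simp only [Fin.lt_def] at p1 p2
      by_cases h : (i : ℕ) ≤ k
      · have pk : IsPeak z i := by
          refine ⟨by rw [← wL i h]; exact p1, ?_⟩
          simp only [Fin.lt_def]
          have q := wF i
          rcases q with q | q
          · rw [q.2.1]; omega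
          · omega
        have sbz : IsStepBackPeak z i := by
          by_contra hcon; exact hin ((hz.2 i).1 ⟨pk, hcon⟩)
        apply p3
        have hwi : w i = z i := by
          rcases wF i with q | q
          · exact q.2.1.symm
          · omega
        unfold IsStepBackPeak at sbz ⊢
        rcases sbz with ⟨q1, q2, q3⟩ | ⟨q1, q2, q3⟩
        · left
          rw [wL i h, hwi]
          refine ⟨q1, q2, ?_⟩
          simp only [Fin.lt_def] at q3 ⊢
          rcases wF (z i) with q | q
          · rw [← q.2.1]; exact q3
          · omega
        · right
          have : ((z⁻¹ i : Fin n) : ℕ) ≤ k := by omega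
          rw [wL i h, hwi, wL _ this]
          exact ⟨q1, q2, q3⟩
      · have h' : k < (i : ℕ) := by omega
        have pk : IsPeak y i := by
          refine ⟨by rw [← wR i h']; exact p1, ?_⟩
          simp only [Fin.lt_def]
          have q := wF i
          rcases q with q | q
          · omega
          · rw [q.2.1]; omega
        have sby : IsStepBackPeak y i := by
          by_contra hcon; exact hin ((hy.2 i).1 ⟨pk, hcon⟩)
        have hik : (i : ℕ) ≠ k + 1 := by
          intro e
          rw [sb_bridge, e] at sby
          exact hSy sby
        apply p3
        unfold IsStepBackPeak at sby ⊢
        rcases sby with ⟨q1, q2, q3⟩ | ⟨q1, q2, q3⟩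
        · left
          have hwi : w i = y i := by
            rcases wF i with q | q
            · omega
            · exact q.2.1.symm
          rw [wR i h', hwi]
          refine ⟨q1, q2, ?_⟩
          simp only [Fin.lt_def] at q3 ⊢
          rcases wF (y i) with q | q
          · omega
          · rw [← q.2.1]; exact q3
        · right
          have : k < ((y⁻¹ i : Fin n) : ℕ) := by omega
          rw [wR i h', wR _ this]
          refine ⟨q1, q2, ?_⟩
          simp only [Fin.lt_def] at q3 ⊢
          rcases wF i with q | q
          · omega
          · rw [← q.2.1]; exact q3
    · intro hi
      have n1 := tour_ne hn w tw i
      have n2 : w⁻¹ i ≠ i := fun e => n1 (by rw [Equiv.Perm.inv_eq_iff_eq] at e; exact e.symm)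
      have n1' : (w i : ℕ) ≠ i := fun e => n1 (Fin.ext e)
      have n2' : ((w⁻¹ i : Fin n) : ℕ) ≠ i := fun e => n2 (Fin.ext e)
      have m1 := (w i).isLt
      have m2 := (w⁻¹ i).isLt
      have m3 := (w (w i)).isLt
      have m4 := (w⁻¹ (w⁻¹ i)).isLt
      simp only [IsPeak, IsStepBackPeak, Fin.lt_def]
      omega
  · funext ⟨i, j⟩
    have c : ∀ τ : Equiv.Perm (Fin n), chv τ (i, j) = if τ⁻¹ j = i then 1 else 0 := by
      intro τ
      simp only [chv, perm_inv_iff]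
    simp only [Pi.add_apply, c]
    by_cases h : (j : ℕ) ≤ k
    · rw [HA j h, wL j h]
    · rw [HB j (by omega), wR j (by omega), add_comm]

/-- ascending/descending version in terms of the abstract encodings -/
theorem core2 (hn : 4 ≤ n) (x y z : Equiv.Perm (Fin n))
    (hx : IsPSB x) (hy : IsPSB y) (hz : IsPSB z) (k : ℕ) (hk : 1 ≤ k) (hk2 : k + 3 ≤ n)
    (hA : ASN n (sN x) (sN x⁻¹) k) (hD : ¬ ASN n (sN x) (sN x⁻¹) (k+1))
    (hDy : ¬ ASN n (sN y) (sN y⁻¹) (k+1))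
    (hS2 : SBN n (sN x) (sN x⁻¹) (k+2) ↔ SBN n (sN y) (sN y⁻¹) (k+2))
    (hL : ∀ m, 1 ≤ m → m ≤ k → (ASN n (sN x) (sN x⁻¹) m ↔ ASN n (sN y) (sN y⁻¹) m) ∧
      (SBN n (sN x) (sN x⁻¹) m ↔ SBN n (sN y) (sN y⁻¹) m))
    (hAz : ASN n (sN z) (sN z⁻¹) k)
    (hS0 : SBN n (sN x) (sN x⁻¹) k ↔ SBN n (sN z) (sN z⁻¹) k)
    (hR : ∀ m, k + 1 ≤ m → m ≤ n - 2 → (ASN n (sN x) (sN x⁻¹) m ↔ ASN n (sN z) (sN z⁻¹) m) ∧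
      (SBN n (sN x) (sN x⁻¹) m ↔ SBN n (sN z) (sN z⁻¹) m)) :
    ∃ w : Equiv.Perm (Fin n), IsPSB w ∧ chv y + chv z = chv x + chv w := by
  have px := toPT hn x hx
  have py := toPT hn y hy
  have pz := toPT hn z hz
  apply core hn x y z hx hy hz k hk2
  · exact py.no_sb k ((hL k hk le_rfl).1.1 hA) hDy
  · exact pz.no_sb k hAz (fun q => hD ((hR (k+1) le_rfl (by omega)).1.2 q))
  · intro i hi
    apply Fin.ext
    rw [← sN_val, ← sN_val]
    exact px.left_eq py k hk hk2 hA hD hDy hS2 hL i hi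
  · intro i hi
    apply Fin.ext
    rw [← sN_val, ← sN_val]
    exact px.right_eq pz k hk hk2 hA hD hAz hS0 hR i hi i.isLt

theorem chv_inv (τ : Equiv.Perm (Fin n)) (i j : Fin n) : chv τ⁻¹ (i, j) = chv τ (j, i) := by
  simp only [chv, perm_inv_iff]

theorem exists_w (hn : 4 ≤ n) (x y z : Equiv.Perm (Fin n))
    (hx : IsPSB x) (hy : IsPSB y) (hz : IsPSB z)
    (k : ℕ) (hk1 : 1 ≤ k) (hk2 : k + 1 ≤ n - 2)
    (hseg : AscAt x k ↔ ¬ AscAt x (k + 1))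
    (hxyk : SamePair x y k) (hxzk : SamePair x z k)
    (hleft : ∀ m : ℕ, 1 ≤ m → m ≤ k → SameEnc x y m)
    (hright : ∀ m : ℕ, k + 1 ≤ m → m ≤ n - 2 → SameEnc x z m) :
    ∃ w : Equiv.Perm (Fin n), IsPSB w ∧ chv y + chv z = chv x + chv w := by
  have px := toPT hn x hx
  have py := toPT hn y hy
  have pz := toPT hn z hz
  simp only [SamePair, SameEnc, asAt_bridge, sbAt_bridge] at hseg hxyk hxzk hleft hright
  by_cases hA : ASN n (sN x) (sN x⁻¹) k
  · have hD := hseg.1 hA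
    exact core2 hn x y z hx hy hz k hk1 (by omega) hA hD (fun q => hD (hxyk.2.1.1.2 q))
      hxyk.2.2 hleft (hxzk.1.1.1 hA) hxzk.1.2 hright
  · have hB : ASN n (sN x) (sN x⁻¹) (k+1) := by
      by_contra q
      exact hA (hseg.2 q)
    have ix := fun m h1 h2 => px.as_inv m h1 h2
    have iy := fun m h1 h2 => py.as_inv m h1 h2
    have iz := fun m h1 h2 => pz.as_inv m h1 h2
    obtain ⟨w, hw, e⟩ := core2 hn x⁻¹ y⁻¹ z⁻¹ (psb_inv x hx) (psb_inv y hy) (psb_inv z hz) k hk1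
      (by omega)
      (by rw [inv_inv, ix k hk1 (by omega)]; exact hA)
      (by rw [inv_inv, ix (k+1) (by omega) (by omega)]; exact fun q => q hB)
      (by rw [inv_inv, iy (k+1) (by omega) (by omega)]; exact fun q => q (hxyk.2.1.1.1 hB))
      (by rw [inv_inv, inv_inv, PT.sb_inv (s := sN x), PT.sb_inv (s := sN y)]; exact hxyk.2.2)
      (by
        intro m h1 h2
        rw [inv_inv, inv_inv, PT.sb_inv (s := sN x), PT.sb_inv (s := sN y), ix m h1 (by omega), iy m h1 (by omega)]
        exact ⟨not_congr (hleft m h1 h2).1, (hleft m h1 h2).2⟩)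
      (by rw [inv_inv, iz k hk1 (by omega)]; exact fun q => hA (hxzk.1.1.2 q))
      (by rw [inv_inv, inv_inv, PT.sb_inv (s := sN x), PT.sb_inv (s := sN z)]; exact hxzk.1.2)
      (by
        intro m h1 h2
        rw [inv_inv, inv_inv, PT.sb_inv (s := sN x), PT.sb_inv (s := sN z), ix m (by omega) (by omega),
          iz m (by omega) (by omega)]
        exact ⟨not_congr (hright m h1 h2).1, (hright m h1 h2).2⟩)
    refine ⟨w⁻¹, psb_inv w hw, ?_⟩
    funext ⟨i, j⟩
    have := congrFun e (j, i)
    simp only [Pi.add_apply, chv_inv] at this ⊢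
    exact this

theorem chv_pos (x y : Equiv.Perm (Fin n)) (h : ∀ i, 0 < chv x (i, y i)) : y = x := by
  ext i
  have := h i
  simp only [chv] at this
  split_ifs at this with q
  · rw [q]
  · exact absurd this (lt_irrefl _)

theorem chv_nonneg (x : Equiv.Perm (Fin n)) (e) : 0 ≤ chv x e := by
  simp only [chv]; split_ifs <;> norm_num

theorem chv_self (x : Equiv.Perm (Fin n)) (i) : chv x (i, x i) = 1 := by
  simp [chv]

end Bridge

/-- If three pairwise adjacent tours share a `0/1`-segment at `(k,k+1)`, and `y`
coincides with `x` to the left while `z` coincides with `x` to the right of it,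
then `y = x` or `z = x`: coinciding parts lie on the same side of the segment. -/
theorem stmt10 (n : ℕ) (hn : 4 ≤ n) (x y z : Equiv.Perm (Fin n))
    (hx : IsPSB x) (hy : IsPSB y) (hz : IsPSB z)
    (hadjxy : x ≠ y → AdjacentIn (PSBvertices n) (chv x) (chv y))
    (hadxz : x ≠ z → AdjacentIn (PSBvertices n) (chv x) (chv z))
    (hadyz : y ≠ z → AdjacentIn (PSBvertices n) (chv y) (chv z))
    (k : ℕ) (hk1 : 1 ≤ k) (hk2 : k + 1 ≤ n - 2)
    (hseg : AscAt x k ↔ ¬ AscAt x (k + 1))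
    (hxyk : SamePair x y k) (hxzk : SamePair x z k)
    (hleft : ∀ m : ℕ, 1 ≤ m → m ≤ k → SameEnc x y m)
    (hright : ∀ m : ℕ, k + 1 ≤ m → m ≤ n - 2 → SameEnc x z m) :
    y = x ∨ z = x := by
  obtain ⟨w, hw, e⟩ := exists_w hn x y z hx hy hz k hk1 hk2 hseg hxyk hxzk hleft hright
  by_cases hyz : y = z
  · left
    subst hyz
    symm
    apply chv_pos
    intro i
    have := congrFun e (i, x i)
    simp only [Pi.add_apply, chv_self] at this
    have := chv_nonneg w (i, x i)
    linarith
  · have hext := (hadyz hyz).2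
    have mem : ∀ τ : Equiv.Perm (Fin n), IsPSB τ → chv τ ∈ convexHull ℝ (PSBvertices n) :=
      fun τ h => subset_convexHull ℝ _ ⟨τ, h, rfl⟩
    have hmid1 : (1/2 : ℝ) • chv y + (1/2 : ℝ) • chv z ∈ segment ℝ (chv y) (chv z) :=
      ⟨1/2, 1/2, by norm_num, by norm_num, by norm_num, rfl⟩
    have hmid2 : (1/2 : ℝ) • chv y + (1/2 : ℝ) • chv z ∈ openSegment ℝ (chv x) (chv w) :=
      ⟨1/2, 1/2, by norm_num, by norm_num, by norm_num, by rw [← smul_add, ← smul_add, e]⟩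
    obtain ⟨α, β, hα, hβ, hab, hc⟩ := hext.2 (mem x hx) (mem w hw) hmid1 hmid2
    rcases hα.lt_or_eq with h | h
    · left
      apply chv_pos
      intro i
      rw [← hc]
      simp only [Pi.add_apply, Pi.smul_apply, smul_eq_mul, chv_self]
      have := mul_nonneg hβ (chv_nonneg z (i, y i))
      linarith
    · right
      apply chv_pos
      intro i
      rw [← hc]
      simp only [Pi.add_apply, Pi.smul_apply, smul_eq_mul, chv_self]
      have := mul_nonneg hα (chv_nonneg y (i, z i))
      linarith
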